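/- arXiv:2107.12175 — 3 statements merged into one kernel-verified Lean document; each statement's English description precedes it below -/
import Mathlib

section
/- Let k be a positive integer, σ ∈ ℝ, and q(t) := c_k·cos(2πk(t+σ)) with c_k := 2^(−1/6)·(πk)^(−1/3). Then for every smooth 1-periodic ξ : ℝ → ℝ the Hessian operator of ℬ at q satisfies A_qξ = −ξ̈ − (2πk)²·ξ + 12(2πk)²·ξ_k·cos(2πk(·+σ)), where ξ_k := 2∫₀¹ ξ(t)·cos(2πk(t+σ)) dt. -/
open Real

/-- L² inner product of 1-periodic functions: `⟨f,g⟩ = ∫₀¹ f(t)g(t) dt`. -/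
noncomputable def ip (f g : ℝ → ℝ) : ℝ := ∫ t in (0:ℝ)..1, f t * g t

/-- The amplitude `c_k = 2^(-1/6) (πk)^(-1/3)`. -/
noncomputable def ck (k : ℕ) : ℝ := 2 ^ (-(1:ℝ)/6) * (Real.pi * k) ^ (-(1:ℝ)/3)

/-- `α_q = ‖q̇‖²/‖q‖² − 1/(2‖q‖⁶)`, with `‖q‖² = ⟨q,q⟩`. -/
noncomputable def alphaQ (q : ℝ → ℝ) : ℝ :=
  ip (deriv q) (deriv q) / ip q q - 1 / (2 * (ip q q) ^ 3)

/-- The Hessian operator of `ℬ` at a critical point `q`: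
`A_q ξ = −ξ̈ + α_q ξ − (2/‖q‖²)(2α_q − 1/‖q‖⁶)⟨q,ξ⟩ q`. -/
noncomputable def Hess (q ξ : ℝ → ℝ) : ℝ → ℝ := fun t =>
  -(deriv (deriv ξ) t) + alphaQ q * ξ t
    - (2 / ip q q) * (2 * alphaQ q - 1 / (ip q q) ^ 3) * ip q ξ * q t

/-- `c_k⁶ = 1 / (2 (πk)²)`. -/
lemma ck_pow_six (k : ℕ) : ck k ^ 6 = 1 / (2 * (π * k) ^ 2) := by
  have hp : (0 : ℝ) ≤ π * k := by positivity
  have h2 : ((2 : ℝ) ^ (-(1 : ℝ) / 6)) ^ 6 = 1 / 2 := by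
    rw [← Real.rpow_natCast, ← Real.rpow_mul (by norm_num)]
    norm_num [Real.rpow_neg_one]
  have h3 : ((π * k : ℝ) ^ (-(1 : ℝ) / 3)) ^ 6 = ((π * k) ^ 2)⁻¹ := by
    rw [← Real.rpow_natCast, ← Real.rpow_mul hp, ← Real.rpow_natCast (π * k) 2,
      ← Real.rpow_neg hp]
    norm_num
  rw [ck, mul_pow, h2, h3]
  ring

/-- The mean of `cos²` over `k` full periods is `1/2`. -/
lemma integral_cos_sq_period (k : ℕ) (hk : 0 < k) (σ : ℝ) :
    ∫ t in (0 : ℝ)..1, cos (2 * π * k * (t + σ)) ^ 2 = 1 / 2 := by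
  have hk' : (k : ℝ) ≠ 0 := by positivity
  have hw : 2 * π * (k : ℝ) ≠ 0 := by positivity
  have hend : 2 * π * k * 1 + 2 * π * k * σ = 2 * π * k * σ + k * (2 * π) := by ring
  simp_rw [mul_add]
  rw [intervalIntegral.integral_comp_mul_add (fun x => cos x ^ 2) hw, integral_cos_sq, hend,
    cos_add_nat_mul_two_pi, sin_add_nat_mul_two_pi, mul_zero, zero_add, smul_eq_mul]
  field_simp
  ring

/-- The mean of `sin²` over `k` full periods is `1/2`. -/
lemma integral_sin_sq_period (k : ℕ) (hk : 0 < k) (σ : ℝ) :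
    ∫ t in (0 : ℝ)..1, sin (2 * π * k * (t + σ)) ^ 2 = 1 / 2 := by
  simp_rw [sin_sq]
  rw [intervalIntegral.integral_sub (by simp)
    (Continuous.intervalIntegrable (by fun_prop) _ _), integral_cos_sq_period k hk]
  norm_num

/-- Explicit form of the Hessian at `q(t) = c_k cos(2πk(t+σ))`:
`A_q ξ = −ξ̈ − (2πk)² ξ + 12(2πk)² ξ_k cos(2πk(·+σ))` with
`ξ_k = 2∫₀¹ ξ(t) cos(2πk(t+σ)) dt`. -/
theorem hessian_explicit_form (k : ℕ) (hk : 0 < k) (σ : ℝ) (q : ℝ → ℝ)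
    (hq : ∀ t, q t = ck k * Real.cos (2 * π * k * (t + σ)))
    (ξ : ℝ → ℝ) (hξ : ContDiff ℝ (⊤ : ℕ∞) ξ) (hξp : Function.Periodic ξ 1) :
    ∀ t, Hess q ξ t =
      -(deriv (deriv ξ) t) - (2 * π * k) ^ 2 * ξ t
        + 12 * (2 * π * k) ^ 2
            * (2 * ∫ r in (0:ℝ)..1, ξ r * Real.cos (2 * π * k * (r + σ)))
            * Real.cos (2 * π * k * (t + σ)) := by
  intro t
  obtain rfl : q = fun t => ck k * cos (2 * π * k * (t + σ)) := funext hq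
  have hk' : (k : ℝ) ≠ 0 := by positivity
  have hc6 := ck_pow_six k
  have hc : ck k ≠ 0 := by unfold ck; positivity
  have hd : deriv (fun t => ck k * cos (2 * π * k * (t + σ))) =
      fun t => -(ck k * (2 * π * k)) * sin (2 * π * k * (t + σ)) := by
    funext s
    have h : HasDerivAt (fun t => 2 * π * k * (t + σ)) (2 * π * k) s := by
      simpa using ((hasDerivAt_id s).add_const σ).const_mul (2 * π * (k : ℝ))
    rw [(h.cos.const_mul (ck k)).deriv]
    ring
  have hqq : ip (fun t => ck k * cos (2 * π * k * (t + σ)))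
      (fun t => ck k * cos (2 * π * k * (t + σ))) = ck k ^ 2 / 2 := by
    simp_rw [ip, ← sq, mul_pow]
    rw [intervalIntegral.integral_const_mul, integral_cos_sq_period k hk]
    ring
  have hdd : ip (deriv fun t => ck k * cos (2 * π * k * (t + σ)))
      (deriv fun t => ck k * cos (2 * π * k * (t + σ))) =
        (2 * π * k) ^ 2 * (ck k ^ 2 / 2) := by
    rw [hd]
    simp_rw [ip, ← sq, mul_pow _ (sin _)]
    rw [intervalIntegral.integral_const_mul, integral_sin_sq_period k hk]
    ring
  have hqξ : ip (fun t => ck k * cos (2 * π * k * (t + σ))) ξ =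
      ck k * ∫ r in (0 : ℝ)..1, ξ r * cos (2 * π * k * (r + σ)) := by
    rw [ip, ← intervalIntegral.integral_const_mul]
    congr 1
    funext r
    ring
  have hcube : (ck k ^ 2 / 2) ^ 3 = 1 / (4 * (2 * π * k) ^ 2) := by
    rw [div_pow, ← pow_mul, hc6]
    field_simp
    norm_num
  have hα : alphaQ (fun t => ck k * cos (2 * π * k * (t + σ))) = -(2 * π * k) ^ 2 := by
    rw [alphaQ, hdd, hqq, hcube]
    field_simp
    ring
  rw [Hess, hα, hqq, hqξ, hcube]
  field_simp
  ring
end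

section
/- Let k be a positive integer and let u : ℝ × ℝ → ℝ be a heat flow line (smooth, 1-periodic in t, u_s := u(s,·) never identically zero, solving ∂_su − ∂_t∂_tu + α_s·u = 0 with α_s := ‖∂_tu_s‖²/‖u_s‖² − 1/(2‖u_s‖⁶)) whose Fourier coefficients converge as s → −∞ to those of a nonzero function a₋cos 2π(k+1)t + b₋sin 2π(k+1)t and as s → +∞ to those of a nonzero function a₊cos 2πkt + b₊sin 2πkt. Then for every s ∈ ℝ the loop u(s,·) lies in the 4-dimensional space V_k spanned by cos 2πkt, sin 2πkt, cos 2π(k+1)t, sin 2π(k+1)t; that is, there are functions a_k, b_k, a_{k+1}, b_{k+1} of s with u(s,t) = a_k(s)cos 2πkt + b_k(s)sin 2πkt + a_{k+1}(s)cos 2π(k+1)t + b_{k+1}(s)sin 2π(k+1)t. -/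
open Real Filter

/-- `α_s = ‖∂_t u_s‖²/‖u_s‖² − 1/(2‖u_s‖⁶)` along a path of loops `s ↦ u_s`. -/
noncomputable def alphaS (u : ℝ → ℝ → ℝ) (s : ℝ) : ℝ :=
  ip (deriv (u s)) (deriv (u s)) / ip (u s) (u s) - 1 / (2 * (ip (u s) (u s)) ^ 3)

/-- The `k`-th cosine Fourier coefficient `a_k(s) = 2∫₀¹ u(s,t) cos(2πkt) dt`. -/
noncomputable def aCoeff (u : ℝ → ℝ → ℝ) (k : ℕ) (s : ℝ) : ℝ :=
  2 * ∫ t in (0:ℝ)..1, u s t * Real.cos (2 * π * k * t)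

/-- The `k`-th sine Fourier coefficient `b_k(s) = 2∫₀¹ u(s,t) sin(2πkt) dt`. -/
noncomputable def bCoeff (u : ℝ → ℝ → ℝ) (k : ℕ) (s : ℝ) : ℝ :=
  2 * ∫ t in (0:ℝ)..1, u s t * Real.sin (2 * π * k * t)

open intervalIntegral in
/-- Differentiation under the integral sign for a jointly `C¹` integrand. -/
theorem hasDerivAt_intervalIntegral_of_contDiff {F : ℝ → ℝ → ℝ}
    (hF : ContDiff ℝ 1 (Function.uncurry F)) (a b s : ℝ) :
    HasDerivAt (fun r => ∫ t in a..b, F r t) (∫ t in a..b, deriv (fun r => F r t) s) s := by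
  have hderiv : ∀ r t, HasDerivAt (fun r => F r t)
      (fderiv ℝ (Function.uncurry F) (r, t) (1, 0)) r := fun r t =>
    (hF.differentiable one_ne_zero (r, t)).hasFDerivAt.comp_hasDerivAt (f := fun r => (r, t)) r
      ((hasDerivAt_id r).prodMk (hasDerivAt_const r t))
  have hcont : Continuous fun p : ℝ × ℝ => fderiv ℝ (Function.uncurry F) p (1, 0) :=
    (hF.continuous_fderiv one_ne_zero).clm_apply continuous_const
  have hFc : ∀ r, Continuous (F r) := fun r =>
    hF.continuous.comp (by fun_prop : Continuous fun t => (r, t))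
  obtain ⟨M, hM⟩ := ((isCompact_closedBall s 1).prod
    (isCompact_uIcc (a := a) (b := b))).exists_bound_of_continuousOn hcont.continuousOn
  have := (hasDerivAt_integral_of_dominated_loc_of_deriv_le (μ := MeasureTheory.volume)
    (F := F) (F' := fun r t => fderiv ℝ (Function.uncurry F) (r, t) (1, 0)) (x₀ := s)
    (bound := fun _ => M) (a := a) (b := b) (Metric.closedBall_mem_nhds s one_pos)
    (Eventually.of_forall fun r => (hFc r).aestronglyMeasurable)
    ((hFc s).intervalIntegrable _ _)
    (hcont.comp (by fun_prop : Continuous fun t => (s, t))).aestronglyMeasurable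
    (Eventually.of_forall fun t ht r hr => hM (r, t) ⟨hr, Set.uIoc_subset_uIcc ht⟩)
    intervalIntegrable_const
    (Eventually.of_forall fun t _ r _ => hderiv r t)).2
  simpa only [(hderiv s _).deriv] using this

/-- Integrating by parts twice against a periodic eigenfunction `e` of `-d²/dt²`. -/
theorem integral_deriv_deriv_mul_of_periodic {f e e' : ℝ → ℝ} {lam : ℝ}
    (hf : ContDiff ℝ 2 f) (hfp : Function.Periodic f 1)
    (he : ∀ t, HasDerivAt e (e' t) t) (he' : ∀ t, HasDerivAt e' (-lam * e t) t)
    (hep : Function.Periodic e 1) (hep' : Function.Periodic e' 1) :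
    ∫ t in (0:ℝ)..1, deriv (deriv f) t * e t = -lam * ∫ t in (0:ℝ)..1, f t * e t := by
  have hec : Continuous e := continuous_iff_continuousAt.2 fun t => (he t).continuousAt
  have hec' : Continuous e' := continuous_iff_continuousAt.2 fun t => (he' t).continuousAt
  have hf1 : ContDiff ℝ 1 (deriv f) := by
    have : ContDiff ℝ (1 + 1) f := by simpa [one_add_one_eq_two] using hf
    exact (contDiff_succ_iff_deriv.1 this).2.2
  have hd : ∀ t, HasDerivAt f (deriv f t) t := fun t =>
    (hf.differentiable two_ne_zero t).hasDerivAt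
  have hd' : ∀ t, HasDerivAt (deriv f) (deriv (deriv f) t) t := fun t =>
    (hf1.differentiable one_ne_zero t).hasDerivAt
  have hdp : deriv f 1 = deriv f 0 := by
    have : (fun t => f (t + 1)) = f := funext hfp
    have h := deriv_comp_add_const (f := f) 1 0
    rw [this] at h
    simpa using h.symm
  have h1 := intervalIntegral.integral_mul_deriv_eq_deriv_mul (a := 0) (b := 1)
    (fun t _ => he t) (fun t _ => hd' t) (hec'.intervalIntegrable _ _)
    ((hf1.continuous_deriv le_rfl).intervalIntegrable _ _)
  have h2 := intervalIntegral.integral_mul_deriv_eq_deriv_mul (a := 0) (b := 1)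
    (fun t _ => he' t) (fun t _ => hd t) ((hec.const_mul _).intervalIntegrable _ _)
    (hf1.continuous.intervalIntegrable _ _)
  have e1 : e 1 = e 0 := by simpa using hep 0
  have e1' : e' 1 = e' 0 := by simpa using hep' 0
  have f1 : f 1 = f 0 := by simpa using hfp 0
  rw [h2, e1, e1', f1, hdp] at h1
  simp only [mul_comm _ (e _)]
  simp only [mul_assoc, intervalIntegral.integral_const_mul] at h1
  rw [h1]
  ring

/-- Solutions of the scalar linear equation `x' = -(lam + α) x` are given by an
exponential. -/
theorem eq_mul_exp_of_hasDerivAt {α x : ℝ → ℝ} {lam : ℝ} (hα : Continuous α)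
    (hx : ∀ s, HasDerivAt x (-(lam + α s) * x s) s) (s : ℝ) :
    x s = x 0 * Real.exp (-(lam * s + ∫ r in (0:ℝ)..s, α r)) := by
  have hA : ∀ s, HasDerivAt (fun s => ∫ r in (0:ℝ)..s, α r) (α s) s := fun s =>
    (hα.integral_hasStrictDerivAt 0 s).hasDerivAt
  have hG : ∀ s, HasDerivAt
      (fun s => x s * Real.exp (lam * s + ∫ r in (0:ℝ)..s, α r)) 0 s := fun s => by
    refine ((hx s).mul (((hasDerivAt_id' s).const_mul lam).add (hA s)).exp).congr_deriv ?_
    ring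
  have := is_const_of_deriv_eq_zero (fun s => (hG s).differentiableAt)
    (fun s => (hG s).deriv) s 0
  simp only [mul_zero, intervalIntegral.integral_same, add_zero, Real.exp_zero, mul_one] at this
  rw [Real.exp_neg, ← this, mul_assoc, mul_inv_cancel₀ (Real.exp_ne_zero _), mul_one]

/-- A solution `x` of `x' = -(lam + α) x` that tends to zero in a direction in which it should
dominate a solution `y` of `y' = -(mu + α) y` with nonzero limit must vanish identically. -/
theorem eq_zero_of_tendsto_zero_of_dominated {α x y : ℝ → ℝ} {lam mu L : ℝ} {l : Filter ℝ}
    [l.NeBot] (hα : Continuous α)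
    (hx : ∀ s, HasDerivAt x (-(lam + α s) * x s) s)
    (hy : ∀ s, HasDerivAt y (-(mu + α s) * y s) s)
    (hxl : Tendsto x l (nhds 0)) (hyl : Tendsto y l (nhds L)) (hL : L ≠ 0)
    (hl : Tendsto (fun s => (lam - mu) * s) l atBot) (s : ℝ) : x s = 0 := by
  have key : ∀ s, x 0 * y s = y 0 * (x s * Real.exp ((lam - mu) * s)) := fun s => by
    rw [eq_mul_exp_of_hasDerivAt hα hx s, eq_mul_exp_of_hasDerivAt hα hy s, mul_assoc (x 0),
      ← Real.exp_add]
    ring_nf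
  have h1 : Tendsto (fun s => x 0 * y s) l (nhds (x 0 * L)) := hyl.const_mul _
  have h2 : Tendsto (fun s => x 0 * y s) l (nhds 0) := by
    simp only [key]
    simpa using (hxl.mul (Real.tendsto_exp_atBot.comp hl)).const_mul (y 0)
  have h0 : x 0 = 0 := by
    simpa [hL] using tendsto_nhds_unique h1 h2
  rw [eq_mul_exp_of_hasDerivAt hα hx s, h0, zero_mul]

theorem re_mul_fourier (c : ℂ) (n : ℤ) (t : ℝ) :
    (c * fourier n (t : AddCircle (1 : ℝ))).re
      = c.re * Real.cos (2 * π * n * t) - c.im * Real.sin (2 * π * n * t) := by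
  have : (2 * π * Complex.I * n * t / (1 : ℝ) : ℂ) = ((2 * π * n * t : ℝ) : ℂ) * Complex.I := by
    push_cast
    ring
  rw [fourier_coe_apply, this, Complex.mul_re, Complex.exp_ofReal_mul_I_re,
    Complex.exp_ofReal_mul_I_im]

theorem fourierCoeff_lift_eq_zero {f : ℝ → ℝ} (hf : Continuous f)
    (hfp : Function.Periodic (fun t => (f t : ℂ)) 1) {n : ℤ}
    (hc : ∫ t in (0:ℝ)..1, f t * Real.cos (2 * π * n * t) = 0)
    (hs : ∫ t in (0:ℝ)..1, f t * Real.sin (2 * π * n * t) = 0) :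
    fourierCoeff (T := 1) hfp.lift n = 0 := by
  rw [fourierCoeff_eq_intervalIntegral _ _ 0]
  have h : ∀ t : ℝ, fourier (-n) (t : AddCircle (1 : ℝ)) • hfp.lift (t : AddCircle (1 : ℝ))
      = ((f t * Real.cos (2 * π * n * t) : ℝ) : ℂ)
        - ((f t * Real.sin (2 * π * n * t) : ℝ) : ℂ) * Complex.I := fun t => by
    have : (2 * π * Complex.I * (-n : ℤ) * t / (1 : ℝ) : ℂ)
        = ((-(2 * π * n * t) : ℝ) : ℂ) * Complex.I := by
      push_cast
      ring
    rw [fourier_coe_apply, this, Complex.exp_mul_I, ← Complex.ofReal_cos, ← Complex.ofReal_sin,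
      Real.cos_neg, Real.sin_neg, Function.Periodic.lift_coe, smul_eq_mul]
    push_cast
    ring
  simp only [h]
  rw [zero_add, intervalIntegral.integral_sub, intervalIntegral.integral_mul_const,
    intervalIntegral.integral_ofReal, intervalIntegral.integral_ofReal, hc, hs]
  · simp
  all_goals exact Continuous.intervalIntegrable (by fun_prop) _ _

/-- A continuous 1-periodic function with finitely many nonzero Fourier coefficients is a
trigonometric polynomial. -/
theorem exists_eq_sum_cos_sin_of_coeff_eq_zero {f : ℝ → ℝ} (hf : Continuous f)
    (hfp : Function.Periodic f 1) (S : Finset ℕ) (h0 : 0 ∉ S)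
    (hc : ∀ n ∉ S, ∫ t in (0:ℝ)..1, f t * Real.cos (2 * π * n * t) = 0)
    (hs : ∀ n ∉ S, ∫ t in (0:ℝ)..1, f t * Real.sin (2 * π * n * t) = 0) :
    ∃ A B : ℕ → ℝ, ∀ t, f t =
      ∑ n ∈ S, (A n * Real.cos (2 * π * n * t) + B n * Real.sin (2 * π * n * t)) := by
  have hfp' : Function.Periodic (fun t => (f t : ℂ)) 1 := fun t => by simp [hfp t]
  let F : C(AddCircle (1 : ℝ), ℂ) :=
    ⟨hfp'.lift, continuous_coinduced_dom.2 (Complex.continuous_ofReal.comp hf)⟩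
  have hz : ∀ n : ℤ, n.natAbs ∉ S → fourierCoeff F n = 0 := fun n hn => by
    have hcn := hc _ hn
    have hsn := hs _ hn
    refine fourierCoeff_lift_eq_zero hf hfp' ?_ ?_
    · rcases n.natAbs_eq with h | h <;> rw [h] <;> simpa using hcn
    · rcases n.natAbs_eq with h | h <;> rw [h] <;> simpa using hsn
  have hsum : Summable (fourierCoeff F) := by
    refine summable_of_hasFiniteSupport (((S.image (fun n : ℕ => (n : ℤ))) ∪
      S.image (fun n : ℕ => -(n : ℤ))).finite_toSet.subset fun n hn => ?_)
    have hn' : n.natAbs ∈ S := by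
      by_contra h
      exact hn (hz n h)
    rcases n.natAbs_eq with h | h <;> simp only [Finset.coe_union, Finset.coe_image, Set.mem_union,
      Set.mem_image, Finset.mem_coe]
    · exact Or.inl ⟨_, hn', h.symm⟩
    · exact Or.inr ⟨_, hn', h.symm⟩
  refine ⟨fun n => (fourierCoeff F n).re + (fourierCoeff F (-n)).re,
    fun n => (fourierCoeff F (-n)).im - (fourierCoeff F n).im, fun t => ?_⟩
  have h1 := (has_pointwise_sum_fourier_series_of_summable hsum (t : AddCircle (1 : ℝ))).nat_add_neg
  have h2 : HasSum _ _ := hasSum_sum_of_ne_finset_zero (s := S) (f := fun n : ℕ =>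
      fourierCoeff F n • fourier n (t : AddCircle (1 : ℝ))
        + fourierCoeff F (-n) • fourier (-n) (t : AddCircle (1 : ℝ))) fun n hn => by
    rw [hz n (by simpa using hn), hz (-n) (by simpa using hn)]
    simp
  have h3 := congrArg Complex.re (h1.unique h2)
  rw [hz 0 (by simpa using h0), zero_smul, add_zero, Complex.re_sum] at h3
  refine (show f t = (F (t : AddCircle (1 : ℝ))).re from rfl).trans (h3.trans ?_)
  refine Finset.sum_congr rfl fun n _ => ?_
  rw [Complex.add_re, smul_eq_mul, smul_eq_mul, re_mul_fourier, re_mul_fourier]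
  simp
  ring

theorem contDiff_section {u : ℝ → ℝ → ℝ} {n : WithTop ℕ∞}
    (hu : ContDiff ℝ n (Function.uncurry u)) (s : ℝ) : ContDiff ℝ n (u s) :=
  hu.comp (contDiff_const.prodMk contDiff_id)

theorem ip_self_pos {f : ℝ → ℝ} (hf : Continuous f) (hfp : Function.Periodic f 1) (h : f ≠ 0) :
    0 < ip f f := by
  obtain ⟨t, ht⟩ := Function.ne_iff.1 h
  obtain ⟨r, hr, hfr⟩ := hfp.exists_mem_Ico₀ one_pos t
  refine intervalIntegral.integral_pos one_pos (by fun_prop) (fun _ _ => mul_self_nonneg _)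
    ⟨r, Set.Ico_subset_Icc_self hr, ?_⟩
  exact mul_self_pos.2 (hfr ▸ ht)

theorem continuous_alphaS {u : ℝ → ℝ → ℝ} (hu : ContDiff ℝ 1 (Function.uncurry u))
    (hup : ∀ s, Function.Periodic (u s) 1) (hu0 : ∀ s, u s ≠ 0) : Continuous (alphaS u) := by
  have hpos : ∀ s, ip (u s) (u s) ≠ 0 := fun s =>
    (ip_self_pos (contDiff_section hu s).continuous (hup s) (hu0 s)).ne'
  have huc : Continuous fun p : ℝ × ℝ => u p.1 p.2 := hu.continuous
  have hdc : Continuous fun p : ℝ × ℝ => deriv (u p.1) p.2 := by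
    have hd : ∀ s t, deriv (u s) t = fderiv ℝ (Function.uncurry u) (s, t) (0, 1) := fun s t =>
      ((hu.differentiable one_ne_zero (s, t)).hasFDerivAt.comp_hasDerivAt (f := fun t => (s, t)) t
        ((hasDerivAt_const t s).prodMk (hasDerivAt_id t))).deriv
    simp only [hd]
    exact (hu.continuous_fderiv one_ne_zero).clm_apply continuous_const
  have h1 : Continuous fun s => ip (u s) (u s) :=
    intervalIntegral.continuous_parametric_intervalIntegral_of_continuous' (huc.mul huc) 0 1
  have h2 : Continuous fun s => ip (deriv (u s)) (deriv (u s)) :=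
    intervalIntegral.continuous_parametric_intervalIntegral_of_continuous' (hdc.mul hdc) 0 1
  exact (h2.div h1 hpos).sub (continuous_const.div ((h1.pow 3).const_mul 2)
    fun s => mul_ne_zero two_ne_zero (pow_ne_zero 3 (hpos s)))

/-- Along a heat flow line, the coefficient with respect to a periodic eigenfunction `e` of
`-d²/dt²` with eigenvalue `lam` satisfies a scalar linear equation. -/
theorem hasDerivAt_coeff {u : ℝ → ℝ → ℝ} (hu : ContDiff ℝ 2 (Function.uncurry u))
    (hup : ∀ s, Function.Periodic (u s) 1)
    (hheat : ∀ s t, deriv (fun r => u r t) s - deriv (deriv (u s)) t + alphaS u s * u s t = 0)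
    {e e' : ℝ → ℝ} {lam : ℝ} (hec : ContDiff ℝ 1 e)
    (he : ∀ t, HasDerivAt e (e' t) t) (he' : ∀ t, HasDerivAt e' (-lam * e t) t)
    (hep : Function.Periodic e 1) (hep' : Function.Periodic e' 1) (s : ℝ) :
    HasDerivAt (fun s => 2 * ∫ t in (0:ℝ)..1, u s t * e t)
      (-(lam + alphaS u s) * (2 * ∫ t in (0:ℝ)..1, u s t * e t)) s := by
  have hus := contDiff_section hu s
  have hus2 : Continuous (deriv (deriv (u s))) := by
    have h : ContDiff ℝ (1 + 1) (u s) := by simpa [one_add_one_eq_two] using hus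
    exact (contDiff_succ_iff_deriv.1 h).2.2.continuous_deriv le_rfl
  have husc := hus.continuous
  have hecc := hec.continuous
  have hF : ContDiff ℝ 1 (Function.uncurry fun s t => u s t * e t) :=
    (hu.of_le one_le_two).mul (hec.comp contDiff_snd)
  refine ((hasDerivAt_intervalIntegral_of_contDiff hF 0 1 s).const_mul 2).congr_deriv ?_
  have hpt : ∀ t, deriv (fun r => u r t * e t) s
      = deriv (deriv (u s)) t * e t - alphaS u s * (u s t * e t) := fun t => by
    have hd : DifferentiableAt ℝ (fun r => u r t) s :=
      (hu.comp (contDiff_id.prodMk contDiff_const)).differentiable two_ne_zero s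
    rw [deriv_mul_const hd]
    linear_combination e t * hheat s t
  rw [funext hpt, intervalIntegral.integral_sub, intervalIntegral.integral_const_mul,
    integral_deriv_deriv_mul_of_periodic hus (hup s) he he' hep hep']
  · ring
  all_goals exact Continuous.intervalIntegrable (by fun_prop) _ _

theorem periodic_cos_two_pi_nat_mul (n : ℕ) :
    Function.Periodic (fun t : ℝ => Real.cos (2 * π * n * t)) 1 := fun t => by
  simp only [mul_add, mul_one, mul_comm (2 * π)]
  exact Real.cos_add_nat_mul_two_pi _ n

theorem periodic_sin_two_pi_nat_mul (n : ℕ) :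
    Function.Periodic (fun t : ℝ => Real.sin (2 * π * n * t)) 1 := fun t => by
  simp only [mul_add, mul_one, mul_comm (2 * π)]
  exact Real.sin_add_nat_mul_two_pi _ n

theorem hasDerivAt_cos_const_mul (c t : ℝ) :
    HasDerivAt (fun t => Real.cos (c * t)) (-c * Real.sin (c * t)) t := by
  refine (((hasDerivAt_id' t).const_mul c).cos).congr_deriv ?_
  ring

theorem hasDerivAt_sin_const_mul (c t : ℝ) :
    HasDerivAt (fun t => Real.sin (c * t)) (c * Real.cos (c * t)) t := by
  refine (((hasDerivAt_id' t).const_mul c).sin).congr_deriv ?_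
  ring

theorem hasDerivAt_aCoeff {u : ℝ → ℝ → ℝ} (hu : ContDiff ℝ 2 (Function.uncurry u))
    (hup : ∀ s, Function.Periodic (u s) 1)
    (hheat : ∀ s t, deriv (fun r => u r t) s - deriv (deriv (u s)) t + alphaS u s * u s t = 0)
    (n : ℕ) (s : ℝ) :
    HasDerivAt (aCoeff u n) (-((2 * π * n) ^ 2 + alphaS u s) * aCoeff u n s) s := by
  refine hasDerivAt_coeff hu hup hheat (by fun_prop) (hasDerivAt_cos_const_mul _) (fun t => ?_)
    (periodic_cos_two_pi_nat_mul n) (fun t => ?_) s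
  · refine ((hasDerivAt_sin_const_mul (2 * π * n) t).const_mul (-(2 * π * n))).congr_deriv ?_
    ring
  · exact congrArg _ (periodic_sin_two_pi_nat_mul n t)

theorem hasDerivAt_bCoeff {u : ℝ → ℝ → ℝ} (hu : ContDiff ℝ 2 (Function.uncurry u))
    (hup : ∀ s, Function.Periodic (u s) 1)
    (hheat : ∀ s t, deriv (fun r => u r t) s - deriv (deriv (u s)) t + alphaS u s * u s t = 0)
    (n : ℕ) (s : ℝ) :
    HasDerivAt (bCoeff u n) (-((2 * π * n) ^ 2 + alphaS u s) * bCoeff u n s) s := by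
  refine hasDerivAt_coeff hu hup hheat (by fun_prop) (hasDerivAt_sin_const_mul _) (fun t => ?_)
    (periodic_sin_two_pi_nat_mul n) (fun t => ?_) s
  · refine ((hasDerivAt_cos_const_mul (2 * π * n) t).const_mul (2 * π * n)).congr_deriv ?_
    ring
  · exact congrArg _ (periodic_cos_two_pi_nat_mul n t)

/-- A heat flow line running from the critical circle `C_{k+1}` (at `s → −∞`) to the
critical circle `C_k` (at `s → +∞`) lies entirely in the 4-dimensional space `V_k`
spanned by `cos 2πkt, sin 2πkt, cos 2π(k+1)t, sin 2π(k+1)t`. -/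
theorem heat_flow_line_lies_in_Vk (k : ℕ) (hk : 0 < k) (u : ℝ → ℝ → ℝ)
    (hu : ContDiff ℝ (⊤ : ℕ∞) (Function.uncurry u))
    (hup : ∀ s, Function.Periodic (u s) 1)
    (hu0 : ∀ s, u s ≠ 0)
    (hheat : ∀ s t, deriv (fun r => u r t) s - deriv (deriv (u s)) t
      + alphaS u s * u s t = 0)
    (ap bp am bm : ℝ) (hp : (ap, bp) ≠ (0, 0)) (hm : (am, bm) ≠ (0, 0))
    (hlimAp : ∀ n : ℕ, Tendsto (aCoeff u n) atTop (nhds (if n = k then ap else 0)))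
    (hlimBp : ∀ n : ℕ, Tendsto (bCoeff u n) atTop (nhds (if n = k then bp else 0)))
    (hlimAm : ∀ n : ℕ, Tendsto (aCoeff u n) atBot (nhds (if n = k + 1 then am else 0)))
    (hlimBm : ∀ n : ℕ, Tendsto (bCoeff u n) atBot (nhds (if n = k + 1 then bm else 0))) :
    ∃ A B C D : ℝ → ℝ, ∀ s t : ℝ,
      u s t = A s * Real.cos (2 * π * k * t) + B s * Real.sin (2 * π * k * t)
        + C s * Real.cos (2 * π * (k + 1) * t)
        + D s * Real.sin (2 * π * (k + 1) * t) := by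
  have hu2 : ContDiff ℝ 2 (Function.uncurry u) := hu.of_le (by exact WithTop.coe_le_coe.2 le_top)
  have hα : Continuous (alphaS u) := continuous_alphaS (hu2.of_le one_le_two) hup hu0
  have hA := hasDerivAt_aCoeff hu2 hup hheat
  have hB := hasDerivAt_bCoeff hu2 hup hheat
  obtain ⟨y, L, hy, hyl, hL⟩ : ∃ (y : ℝ → ℝ) (L : ℝ),
      (∀ s, HasDerivAt y (-((2 * π * k) ^ 2 + alphaS u s) * y s) s) ∧
        Tendsto y atTop (nhds L) ∧ L ≠ 0 := by
    by_cases h : ap = 0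
    · exact ⟨_, _, hB k, hlimBp k, by simpa [h] using hp⟩
    · exact ⟨_, _, hA k, hlimAp k, by simpa using h⟩
  obtain ⟨z, M, hz, hzl, hM⟩ : ∃ (z : ℝ → ℝ) (M : ℝ),
      (∀ s, HasDerivAt z (-((2 * π * (k + 1 : ℕ)) ^ 2 + alphaS u s) * z s) s) ∧
        Tendsto z atBot (nhds M) ∧ M ≠ 0 := by
    by_cases h : am = 0
    · exact ⟨_, _, hB (k + 1), hlimBm (k + 1), by simpa [h] using hm⟩
    · exact ⟨_, _, hA (k + 1), hlimAm (k + 1), by simpa using h⟩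
  have hsq : ∀ {m n : ℕ}, m < n → (2 * π * m) ^ 2 - (2 * π * n) ^ 2 < 0 := fun {m n} h => by
    have : (m : ℝ) < n := by exact_mod_cast h
    have := Real.pi_pos
    exact sub_neg.2 (by gcongr)
  have hzero : ∀ n ∉ ({k, k + 1} : Finset ℕ), ∀ s, aCoeff u n s = 0 ∧ bCoeff u n s = 0 := by
    intro n hn s
    simp only [Finset.mem_insert, Finset.mem_singleton, not_or] at hn
    rcases lt_or_gt_of_ne hn.1 with h | h
    · have hl := tendsto_id.const_mul_atTop_of_neg (hsq h)
      exact ⟨eq_zero_of_tendsto_zero_of_dominated hα (hA n) hy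
          (by simpa [hn.1] using hlimAp n) hyl hL hl s,
        eq_zero_of_tendsto_zero_of_dominated hα (hB n) hy
          (by simpa [hn.1] using hlimBp n) hyl hL hl s⟩
    · have hl := tendsto_id.const_mul_atBot
        (sub_pos.2 (sub_neg.1 (hsq (show k + 1 < n by omega))))
      exact ⟨eq_zero_of_tendsto_zero_of_dominated hα (hA n) hz
          (by simpa [hn.2] using hlimAm n) hzl hM hl s,
        eq_zero_of_tendsto_zero_of_dominated hα (hB n) hz
          (by simpa [hn.2] using hlimBm n) hzl hM hl s⟩
  choose A B hAB using fun s => exists_eq_sum_cos_sin_of_coeff_eq_zero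
    (contDiff_section hu s).continuous (hup s) {k, k + 1} (by simp [hk.ne])
    (fun n hn => by simpa [aCoeff] using (hzero n hn s).1)
    (fun n hn => by simpa [bCoeff] using (hzero n hn s).2)
  refine ⟨fun s => A s k, fun s => B s k, fun s => A s (k + 1), fun s => B s (k + 1),
    fun s t => ?_⟩
  rw [hAB s t, Finset.sum_pair (by simp)]
  push_cast
  ring
end

section
/- Let u : ℝ × ℝ → ℝ be smooth, 1-periodic in its second variable, with u_s := u(s,·) never identically zero, and let ξ, η : ℝ × ℝ → ℝ be smooth, 1-periodic in t, and compactly supported in s. Then ∫_ℝ 4‖u_s‖²·⟨(D_uξ)_s, η_s⟩ ds = ∫_ℝ 4‖u_s‖²·⟨ξ_s, (D_u*η)_s⟩ ds, where D_uξ := ∂_sξ − ∂_t∂_tξ + α_s·ξ − (2/‖u_s‖²)·(⟨∂_t∂_tu_s, ξ_s⟩ + (α_s − 1/‖u_s‖⁶)·⟨u_s, ξ_s⟩)·u and D_u*η := −∂_sη − ∂_t∂_tη + α_s·η − 2(⟨u_s, ∂_su_s⟩/‖u_s‖²)·η − 2(⟨u_s, η_s⟩/‖u_s‖²)·∂_t∂_tu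 − 2(‖∂_tu_s‖²/‖u_s‖⁴ − (3/2)/‖u_s‖⁸)·⟨u_s, η_s⟩·u. -/
open Real MeasureTheory

/-- The linearization `D_u` of the non-local heat operator at `u`. -/
noncomputable def Du (u ξ : ℝ → ℝ → ℝ) (s t : ℝ) : ℝ :=
  deriv (fun r => ξ r t) s - deriv (deriv (ξ s)) t + alphaS u s * ξ s t
    - (2 / ip (u s) (u s))
        * (ip (deriv (deriv (u s))) (ξ s)
            + (alphaS u s - 1 / (ip (u s) (u s)) ^ 3) * ip (u s) (ξ s))
        * u s t

/-- The formal `L²_u` adjoint `D_u*` of the linearization `D_u`. -/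
noncomputable def DuStar (u η : ℝ → ℝ → ℝ) (s t : ℝ) : ℝ :=
  -(deriv (fun r => η r t) s) - deriv (deriv (η s)) t + alphaS u s * η s t
    - 2 * (ip (u s) (fun τ => deriv (fun r => u r τ) s) / ip (u s) (u s)) * η s t
    - 2 * (ip (u s) (η s) / ip (u s) (u s)) * deriv (deriv (u s)) t
    - 2 * (ip (deriv (u s)) (deriv (u s)) / (ip (u s) (u s)) ^ 2
            - (3 / 2) / (ip (u s) (u s)) ^ 4) * ip (u s) (η s) * u s t

open Function Set Filter Topology

lemma ip_comm (f g : ℝ → ℝ) : ip f g = ip g f := by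
  simp only [ip, mul_comm]

lemma ip_add_left {f g h : ℝ → ℝ} (hf : Continuous f) (hg : Continuous g) (hh : Continuous h) :
    ip (fun t => f t + g t) h = ip f h + ip g h := by
  simp only [ip, add_mul]
  exact intervalIntegral.integral_add ((hf.mul hh).intervalIntegrable 0 1)
    ((hg.mul hh).intervalIntegrable 0 1)

lemma ip_smul_left (c : ℝ) (f h : ℝ → ℝ) : ip (fun t => c * f t) h = c * ip f h := by
  simp only [ip, mul_assoc, intervalIntegral.integral_const_mul]

lemma ip_neg_left (f h : ℝ → ℝ) : ip (fun t => -f t) h = -ip f h := by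
  simp only [ip, neg_mul, intervalIntegral.integral_neg]

lemma ip_sub_left {f g h : ℝ → ℝ} (hf : Continuous f) (hg : Continuous g) (hh : Continuous h) :
    ip (fun t => f t - g t) h = ip f h - ip g h := by
  simp only [sub_eq_add_neg]
  rw [ip_add_left hf (by fun_prop) hh, ip_neg_left]

/-- A continuous periodic function of vanishing `L²` norm is zero. -/
lemma ip_self_ne_zero {f : ℝ → ℝ} (hf : Continuous f) (hp : Periodic f 1) (h0 : f ≠ 0) :
    ip f f ≠ 0 := by
  obtain ⟨x, hx⟩ := Function.ne_iff.mp h0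
  obtain ⟨y, hy, hxy⟩ := hp.exists_mem_Ico₀ one_pos x
  have hy0 : f y ≠ 0 := hxy ▸ hx
  refine (intervalIntegral.integral_pos one_pos (hf.mul hf).continuousOn
    (fun t _ => mul_self_nonneg (f t)) ⟨y, Ico_subset_Icc_self hy, ?_⟩).ne'
  exact mul_self_pos.mpr hy0

lemma Function.Periodic.deriv_real {f : ℝ → ℝ} {c : ℝ} (hp : Periodic f c) :
    Periodic (deriv f) c := fun x => by
  rw [← deriv_comp_add_const, show (fun y => f (y + c)) = f from funext hp]

/-- Integration by parts for periodic functions. -/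
lemma ip_deriv_left {f g : ℝ → ℝ} (hf : ContDiff ℝ 1 f) (hg : ContDiff ℝ 1 g)
    (hfp : Periodic f 1) (hgp : Periodic g 1) : ip (deriv f) g = -ip f (deriv g) := by
  have h := intervalIntegral.integral_mul_deriv_eq_deriv_mul (a := 0) (b := 1)
    (fun x _ => (hf.differentiable one_ne_zero x).hasDerivAt)
    (fun x _ => (hg.differentiable one_ne_zero x).hasDerivAt)
    ((hf.continuous_deriv le_rfl).intervalIntegrable 0 1)
    ((hg.continuous_deriv le_rfl).intervalIntegrable 0 1)
  have hf1 : f 1 = f 0 := by simpa using hfp 0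
  have hg1 : g 1 = g 0 := by simpa using hgp 0
  rw [hf1, hg1] at h
  simp only [ip]
  linarith

/-- The second derivative is symmetric on periodic functions. -/
lemma ip_deriv_deriv_left {f g : ℝ → ℝ} (hf : ContDiff ℝ 2 f) (hg : ContDiff ℝ 2 g)
    (hfp : Periodic f 1) (hgp : Periodic g 1) :
    ip (deriv (deriv f)) g = ip f (deriv (deriv g)) := by
  have hf1 : ContDiff ℝ 1 f := hf.of_le one_le_two
  have hg1 : ContDiff ℝ 1 g := hg.of_le one_le_two
  have hf' : ContDiff ℝ 1 (deriv f) := ContDiff.deriv' hf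
  have hg' : ContDiff ℝ 1 (deriv g) := ContDiff.deriv' hg
  rw [ip_deriv_left hf' hg1 hfp.deriv_real hgp, ip_deriv_left hf1 hg' hfp hgp.deriv_real, neg_neg]

lemma ContDiff.uncurry_slice {v : ℝ → ℝ → ℝ} {n : WithTop ℕ∞} (hv : ContDiff ℝ n (uncurry v))
    (s : ℝ) : ContDiff ℝ n (v s) :=
  hv.comp (contDiff_prodMk_right s)

lemma ContDiff.hasDerivAt_uncurry_left {v : ℝ → ℝ → ℝ} (hv : ContDiff ℝ 1 (uncurry v))
    (s t : ℝ) : HasDerivAt (fun r => v r t) (deriv (fun r => v r t) s) s :=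
  ((hv.comp (contDiff_prodMk_left t)).differentiable one_ne_zero s).hasDerivAt

lemma ContDiff.continuous_deriv_uncurry_left {v : ℝ → ℝ → ℝ} (hv : ContDiff ℝ 1 (uncurry v)) :
    Continuous (uncurry fun s t => deriv (fun r => v r t) s) := by
  have h : (uncurry fun s t => deriv (fun r => v r t) s)
      = fun p => fderiv ℝ (uncurry v) p (1, 0) := by
    ext ⟨s, t⟩
    have h1 : HasDerivAt (fun r : ℝ => (r, t)) ((1 : ℝ), (0 : ℝ)) s :=
      (hasDerivAt_id s).prodMk (hasDerivAt_const s t)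
    exact ((hv.differentiable one_ne_zero (s, t)).hasFDerivAt.comp_hasDerivAt s h1).deriv
  rw [h]
  exact (hv.continuous_fderiv one_ne_zero).clm_apply continuous_const

lemma continuous_ip {f g : ℝ → ℝ → ℝ} (hf : Continuous (uncurry f)) (hg : Continuous (uncurry g)) :
    Continuous fun s => ip (f s) (g s) :=
  intervalIntegral.continuous_parametric_intervalIntegral_of_continuous' (hf.mul hg) 0 1

/-- Differentiation under the integral sign for the `L²` inner product. -/
lemma hasDerivAt_ip {f g : ℝ → ℝ → ℝ} (hf : ContDiff ℝ 1 (uncurry f))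
    (hg : ContDiff ℝ 1 (uncurry g)) (s : ℝ) :
    HasDerivAt (fun r => ip (f r) (g r))
      (ip (fun t => deriv (fun r => f r t) s) (g s)
        + ip (f s) (fun t => deriv (fun r => g r t) s)) s := by
  have hf' := hf.continuous_deriv_uncurry_left
  have hg' := hg.continuous_deriv_uncurry_left
  set F' : ℝ → ℝ → ℝ := fun s t =>
    deriv (fun r => f r t) s * g s t + f s t * deriv (fun r => g r t) s with hF'
  have hF'c : Continuous (uncurry F') := (hf'.mul hg.continuous).add (hf.continuous.mul hg')
  have hFc : ∀ r, Continuous fun t => f r t * g r t := fun r =>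
    (hf.uncurry_slice r).continuous.mul (hg.uncurry_slice r).continuous
  obtain ⟨C, hC⟩ := ((isCompact_Icc (a := s - 1) (b := s + 1)).prod
    (isCompact_Icc (a := (0 : ℝ)) (b := 1))).exists_bound_of_continuousOn hF'c.continuousOn
  have key := (intervalIntegral.hasDerivAt_integral_of_dominated_loc_of_deriv_le (μ := volume)
    (a := 0) (b := 1) (F := fun r t => f r t * g r t) (F' := F') (bound := fun _ => C)
    (Icc_mem_nhds (sub_one_lt s) (lt_add_one s))
    (Eventually.of_forall fun r => (hFc r).aestronglyMeasurable)
    ((hFc s).intervalIntegrable 0 1)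
    (hF'c.comp (Continuous.prodMk_right s)).aestronglyMeasurable
    (Eventually.of_forall fun t ht x hx => hC (x, t) ⟨hx, by
      rw [uIoc_of_le zero_le_one] at ht
      exact Ioc_subset_Icc_self ht⟩)
    intervalIntegrable_const
    (Eventually.of_forall fun t _ x _ =>
      (hf.hasDerivAt_uncurry_left x t).mul (hg.hasDerivAt_uncurry_left x t))).2
  have hsum := intervalIntegral.integral_add (μ := volume)
    (((hf'.comp (Continuous.prodMk_right s)).mul
      (hg.uncurry_slice s).continuous).intervalIntegrable 0 1)
    (((hf.uncurry_slice s).continuous.mul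
      (hg'.comp (Continuous.prodMk_right s))).intervalIntegrable 0 1)
  exact hsum ▸ key

/-- Adding an integrable function of zero integral does not change the integral. -/
lemma integral_eq_of_sub_eq {f g h : ℝ → ℝ} (hh : Integrable h) (h0 : ∫ s, h s = 0)
    (hfg : ∀ s, f s - g s = h s) : ∫ s, f s = ∫ s, g s := by
  have hf : f = fun s => g s + h s := funext fun s => by linarith [hfg s]
  by_cases hg : Integrable g
  · rw [hf, integral_add hg hh, h0, add_zero]
  · rw [integral_undef hg, integral_undef]
    rw [hf]
    exact fun hcon => hg ((integrable_add_iff_integrable_left hh).mp hcon)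

lemma ip_Du {u ξ : ℝ → ℝ → ℝ} (hu : ContDiff ℝ 2 (uncurry u)) (hξ : ContDiff ℝ 2 (uncurry ξ))
    {g : ℝ → ℝ} (hg : Continuous g) (s : ℝ) :
    ip (fun t => Du u ξ s t) g = ip (fun t => deriv (fun r => ξ r t) s) g
      - ip (deriv (deriv (ξ s))) g + alphaS u s * ip (ξ s) g
      - (2 / ip (u s) (u s))
        * (ip (deriv (deriv (u s))) (ξ s)
            + (alphaS u s - 1 / (ip (u s) (u s)) ^ 3) * ip (u s) (ξ s)) * ip (u s) g := by
  have c1 : Continuous fun t => deriv (fun r => ξ r t) s :=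
    (hξ.of_le one_le_two).continuous_deriv_uncurry_left.comp (Continuous.prodMk_right s)
  have c2 : Continuous (deriv (deriv (ξ s))) :=
    (ContDiff.deriv' (n := 1) (hξ.uncurry_slice s)).continuous_deriv le_rfl
  have c3 := (hξ.uncurry_slice s).continuous
  have c4 := (hu.uncurry_slice s).continuous
  simp only [Du]
  rw [ip_sub_left (by fun_prop) (by fun_prop) hg, ip_add_left (by fun_prop) (by fun_prop) hg,
    ip_sub_left c1 c2 hg, ip_smul_left, ip_smul_left]

lemma ip_DuStar {u η : ℝ → ℝ → ℝ} (hu : ContDiff ℝ 2 (uncurry u)) (hη : ContDiff ℝ 2 (uncurry η))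
    {g : ℝ → ℝ} (hg : Continuous g) (s : ℝ) :
    ip g (fun t => DuStar u η s t) = -ip g (fun t => deriv (fun r => η r t) s)
      - ip g (deriv (deriv (η s))) + alphaS u s * ip g (η s)
      - 2 * (ip (u s) (fun τ => deriv (fun r => u r τ) s) / ip (u s) (u s)) * ip g (η s)
      - 2 * (ip (u s) (η s) / ip (u s) (u s)) * ip g (deriv (deriv (u s)))
      - 2 * (ip (deriv (u s)) (deriv (u s)) / (ip (u s) (u s)) ^ 2
            - (3 / 2) / (ip (u s) (u s)) ^ 4) * ip (u s) (η s) * ip g (u s) := by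
  have c1 : Continuous fun t => deriv (fun r => η r t) s :=
    (hη.of_le one_le_two).continuous_deriv_uncurry_left.comp (Continuous.prodMk_right s)
  have c2 : Continuous (deriv (deriv (η s))) :=
    (ContDiff.deriv' (n := 1) (hη.uncurry_slice s)).continuous_deriv le_rfl
  have c3 := (hη.uncurry_slice s).continuous
  have c4 := (hu.uncurry_slice s).continuous
  have c5 : Continuous (deriv (deriv (u s))) :=
    (ContDiff.deriv' (n := 1) (hu.uncurry_slice s)).continuous_deriv le_rfl
  simp only [DuStar, ip_comm g]
  rw [ip_sub_left (by fun_prop) (by fun_prop) hg, ip_sub_left (by fun_prop) (by fun_prop) hg,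
    ip_sub_left (by fun_prop) (by fun_prop) hg, ip_add_left (by fun_prop) (by fun_prop) hg,
    ip_sub_left (by fun_prop) c2 hg, ip_neg_left, ip_smul_left, ip_smul_left, ip_smul_left,
    ip_smul_left]

/-- `D_u*` is the adjoint of `D_u` with respect to the `L²_u` inner product
`(ξ, η) ↦ ∫_ℝ 4‖u_s‖² ⟨ξ_s, η_s⟩ ds` on `t`-periodic, `s`-compactly supported fields. -/
theorem adjoint_identity (u : ℝ → ℝ → ℝ)
    (hu : ContDiff ℝ (⊤ : ℕ∞) (Function.uncurry u))
    (hup : ∀ s, Function.Periodic (u s) 1)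
    (hu0 : ∀ s, u s ≠ 0)
    (ξ η : ℝ → ℝ → ℝ)
    (hξ : ContDiff ℝ (⊤ : ℕ∞) (Function.uncurry ξ))
    (hη : ContDiff ℝ (⊤ : ℕ∞) (Function.uncurry η))
    (hξp : ∀ s, Function.Periodic (ξ s) 1)
    (hηp : ∀ s, Function.Periodic (η s) 1)
    (hξc : ∃ R : ℝ, ∀ s t : ℝ, R < |s| → ξ s t = 0)
    (hηc : ∃ R : ℝ, ∀ s t : ℝ, R < |s| → η s t = 0) :
    ∫ s : ℝ, 4 * ip (u s) (u s) * ip (fun t => Du u ξ s t) (η s)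
      = ∫ s : ℝ, 4 * ip (u s) (u s) * ip (ξ s) (fun t => DuStar u η s t) := by
  have two_le_infty : (2 : WithTop ℕ∞) ≤ ((⊤ : ℕ∞) : WithTop ℕ∞) :=
    WithTop.coe_le_coe.mpr (le_top : (2 : ℕ∞) ≤ ⊤)
  have hu2 : ContDiff ℝ 2 (uncurry u) := hu.of_le two_le_infty
  have hξ2 : ContDiff ℝ 2 (uncurry ξ) := hξ.of_le two_le_infty
  have hη2 : ContDiff ℝ 2 (uncurry η) := hη.of_le two_le_infty
  have hu1 : ContDiff ℝ 1 (uncurry u) := hu2.of_le one_le_two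
  have hξ1 : ContDiff ℝ 1 (uncurry ξ) := hξ2.of_le one_le_two
  have hη1 : ContDiff ℝ 1 (uncurry η) := hη2.of_le one_le_two
  set F : ℝ → ℝ := fun s => 4 * ip (u s) (u s) * ip (ξ s) (η s) with hF
  set F' : ℝ → ℝ := fun s =>
    4 * (ip (fun t => deriv (fun r => u r t) s) (u s)
        + ip (u s) (fun t => deriv (fun r => u r t) s)) * ip (ξ s) (η s)
      + 4 * ip (u s) (u s) * (ip (fun t => deriv (fun r => ξ r t) s) (η s)
        + ip (ξ s) (fun t => deriv (fun r => η r t) s)) with hF'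
  have hderiv : ∀ s, HasDerivAt F (F' s) s := fun s =>
    ((hasDerivAt_ip hu1 hu1 s).const_mul 4).mul (hasDerivAt_ip hξ1 hη1 s)
  have hF'c : Continuous F' := by
    have cu := hu1.continuous_deriv_uncurry_left
    have cξ := hξ1.continuous_deriv_uncurry_left
    have cη := hη1.continuous_deriv_uncurry_left
    have h1 := continuous_ip cu hu.continuous
    have h2 := continuous_ip hu.continuous cu
    have h3 := continuous_ip hξ.continuous hη.continuous
    have h4 := continuous_ip hu.continuous hu.continuous
    have h5 := continuous_ip cξ hη.continuous
    have h6 := continuous_ip hξ.continuous cη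
    fun_prop
  obtain ⟨R, hR⟩ := hξc
  have hFs : HasCompactSupport F := by
    refine HasCompactSupport.intro (isCompact_Icc (a := -R) (b := R)) fun s hs => ?_
    have hs' : R < |s| := not_le.mp fun h => hs (abs_le.mp h)
    simp [hF, ip, hR s _ hs']
  have hF'eq : deriv F = F' := funext fun s => (hderiv s).deriv
  have hF's : HasCompactSupport F' := hF'eq ▸ hFs.deriv
  have hFint : Integrable F :=
    (continuous_iff_continuousAt.mpr fun s => (hderiv s).continuousAt).integrable_of_hasCompactSupport
      hFs
  have hF'int : Integrable F' := hF'c.integrable_of_hasCompactSupport hF's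
  refine integral_eq_of_sub_eq hF'int
    (integral_eq_zero_of_hasDerivAt_of_integrable hderiv hF'int hFint) fun s => ?_
  have hN : ip (u s) (u s) ≠ 0 :=
    ip_self_ne_zero (hu2.uncurry_slice s).continuous (hup s) (hu0 s)
  rw [ip_Du hu2 hξ2 (hη2.uncurry_slice s).continuous, ip_DuStar hu2 hη2
    (hξ2.uncurry_slice s).continuous, ip_deriv_deriv_left (hξ2.uncurry_slice s)
    (hη2.uncurry_slice s) (hξp s) (hηp s), ip_comm (ξ s) (u s),
    ip_comm (ξ s) (deriv (deriv (u s)))]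
  simp only [hF', alphaS, ip_comm (fun t => deriv (fun r => u r t) s) (u s)]
  field_simp
  ring
end
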